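/- In the subshift X on Σ = {a, b, c} consisting of all infinite words in which every block of length three has pairwise distinct letters, define ψ₁ on the constructible sets by ψ₁(A) = 1 if the one-letter word c belongs to A, and ψ₁(A) = 0 otherwise. Then ψ₁ is an ultra-character on E(X) which is not essentially tight; consequently ψ₁ ≠ φ_ω for every ω ∈ X. -/

import Mathlib

open Set

variable {α : Type*}

/-- The left shift map on infinite words. -/
def lshift (x : ℕ → α) : ℕ → α := fun n => x (n + 1)

/-- The finite word `w` occurs as a consecutive block of the infinite word `x`. -/
def OccursIn (w : List α) (x : ℕ → α) : Prop :=
  ∃ k : ℕ, ∀ i : Fin w.length, w.get i = x (k + (i : ℕ))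

/-- The language of `X`: all nonempty finite words occurring as a consecutive block
of some member of `X`. -/
def language (X : Set (ℕ → α)) : Set (List α) :=
  {w | w ≠ [] ∧ ∃ x ∈ X, OccursIn w x}

/-- `F_Λ = {s ∈ L_X : ts ∈ L_X for every t ∈ Λ}`. -/
def FLam (X : Set (ℕ → α)) (Λ : Finset (List α)) : Set (List α) :=
  {s | s ∈ language X ∧ ∀ t ∈ Λ, t ++ s ∈ language X}

/-- The constructible subsets of the language: `∅` and the sets `uF_Λ` with `Λ` a finite
set of words, each empty or in `L_X`, at least one in `L_X`, and `u ∈ Λ`. -/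
def Constructible (X : Set (ℕ → α)) (A : Set (List α)) : Prop :=
  A = ∅ ∨ ∃ (Λ : Finset (List α)) (u : List α),
    (∀ t ∈ Λ, t = [] ∨ t ∈ language X) ∧ (∃ t ∈ Λ, t ∈ language X) ∧ u ∈ Λ ∧
    A = (fun s => u ++ s) '' FLam X Λ

/-- `σ_ω`: the set of nonempty finite prefixes of the infinite word `ω`. -/
def infPrefixes (ω : ℕ → α) : Set (List α) :=
  {w | w ≠ [] ∧ ∀ i : Fin w.length, w.get i = ω (i : ℕ)}

/-- Concatenation of a finite word with an infinite word. -/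
def wcat (w : List α) (x : ℕ → α) : ℕ → α :=
  fun n => if h : n < w.length then w.get ⟨n, h⟩ else x (n - w.length)

/-- A character on the semilattice `E(X)` of constructible sets: a `{0,1}`-valued map
vanishing at `∅`, multiplicative on constructible sets, and not identically zero. -/
def IsCharacter (X : Set (ℕ → α)) (φ : Set (List α) → Bool) : Prop :=
  φ ∅ = false ∧
  (∀ A B : Set (List α), Constructible X A → Constructible X B →
    φ (A ∩ B) = (φ A && φ B)) ∧
  (∃ A : Set (List α), Constructible X A ∧ φ A = true)

/-- An essentially tight character: `φ(A) = max φ(Bᵢ)` whenever `A, B₁, …, B_n` are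
constructible and the symmetric difference `A Δ (B₁ ∪ … ∪ B_n)` is finite. -/
def IsEssTightChar (X : Set (ℕ → α)) (φ : Set (List α) → Bool) : Prop :=
  ∀ (A : Set (List α)) (n : ℕ) (B : Fin n → Set (List α)),
    Constructible X A → (∀ i, Constructible X (B i)) →
    (symmDiff A (⋃ i, B i)).Finite →
    (φ A = true ↔ ∃ i, φ (B i) = true)

/-- A filter on `E(X)`: a family of nonempty constructible sets closed under
intersection and upward closed among constructible sets. -/
def IsCFilter (X : Set (ℕ → α)) (ξ : Set (Set (List α))) : Prop :=
  (∀ A ∈ ξ, Constructible X A ∧ A ≠ ∅) ∧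
  (∀ A ∈ ξ, ∀ B ∈ ξ, A ∩ B ∈ ξ) ∧
  (∀ A ∈ ξ, ∀ B : Set (List α), Constructible X B → A ⊆ B → B ∈ ξ)

/-- An ultrafilter on `E(X)`: a filter maximal among filters. -/
def IsCUltrafilter (X : Set (ℕ → α)) (ξ : Set (Set (List α))) : Prop :=
  IsCFilter X ξ ∧ ∀ ξ' : Set (Set (List α)), IsCFilter X ξ' → ξ ⊆ ξ' → ξ' = ξ

/-- An ultra-character: a character whose family of `1`-valued constructible sets is an
ultrafilter on `E(X)`. -/
def IsUltraChar (X : Set (ℕ → α)) (φ : Set (List α) → Bool) : Prop :=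
  IsCharacter X φ ∧ IsCUltrafilter X {A | Constructible X A ∧ φ A = true}

/-- The subshift on the three-letter alphabet `{a,b,c} = {0,1,2}` consisting of all
infinite words in which every block of length three has pairwise distinct letters. -/
def X3 : Set (ℕ → Fin 3) :=
  {ω | ∀ n : ℕ, ω n ≠ ω (n + 1) ∧ ω n ≠ ω (n + 2) ∧ ω (n + 1) ≠ ω (n + 2)}

open scoped Classical in
/-- `ψ₁(A) = 1` iff the one-letter word `c = 2` belongs to `A`. -/
noncomputable def psi1 : Set (List (Fin 3)) → Bool :=
  fun A => if ([2] : List (Fin 3)) ∈ A then true else false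

theorem lang3 {a b c : Fin 3} {r : List (Fin 3)} (h : a :: b :: c :: r ∈ language X3) :
    a ≠ b ∧ a ≠ c ∧ b ≠ c := by
  obtain ⟨-, x, hx, k, hk⟩ := h
  have h0 := hk ⟨0, by simp⟩
  have h1 := hk ⟨1, by simp⟩
  have h2 := hk ⟨2, by simp⟩
  simp at h0 h1 h2
  rw [h0, h1, h2]
  exact hx k

theorem per_mem (a b c : Fin 3) (hab : a ≠ b) (hac : a ≠ c) (hbc : b ≠ c) :
    (fun n : ℕ => if n % 3 = 0 then a else if n % 3 = 1 then b else c) ∈ X3 := by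
  intro n
  have h : n % 3 = 0 ∨ n % 3 = 1 ∨ n % 3 = 2 := by omega
  rcases h with h | h | h <;> simp [Nat.add_mod, h] <;> tauto

theorem mem3 (a b c : Fin 3) (hab : a ≠ b) (hac : a ≠ c) (hbc : b ≠ c) :
    [a, b, c] ∈ language X3 ∧ [a, b] ∈ language X3 ∧ [a] ∈ language X3 := by
  refine ⟨⟨by simp, _, per_mem a b c hab hac hbc, 0, ?_⟩,
    ⟨by simp, _, per_mem a b c hab hac hbc, 0, ?_⟩,
    ⟨by simp, _, per_mem a b c hab hac hbc, 0, ?_⟩⟩ <;>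
  · intro i
    fin_cases i <;> simp

theorem FLam_c : FLam X3 {[], [0, 1], [1, 0]} = {[2]} := by
  have h1 := mem3 0 1 2 (by decide) (by decide) (by decide)
  have h2 := mem3 1 0 2 (by decide) (by decide) (by decide)
  have h3 := mem3 2 0 1 (by decide) (by decide) (by decide)
  ext s
  simp only [FLam, Set.mem_setOf_eq, Set.mem_singleton_iff]
  constructor
  · rintro ⟨hs, ht⟩
    have ha := ht [0, 1] (by simp)
    have hb := ht [1, 0] (by simp)
    match s, hs with
    | [], hs => exact absurd rfl hs.1
    | [x], _ =>
      have := lang3 ha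
      have : x = 2 := by omega
      rw [this]
    | x :: y :: r, hs =>
      exfalso
      have e1 := lang3 ha
      obtain ⟨-, x', hx, k, hk⟩ := ha
      have g1 := hk ⟨1, by simp⟩
      have g2 := hk ⟨2, by simp⟩
      have g3 := hk ⟨3, by simp⟩
      obtain ⟨-, x'', hx', k', hk'⟩ := hb
      have f1 := hk' ⟨1, by simp⟩
      have f2 := hk' ⟨2, by simp⟩
      have f3 := hk' ⟨3, by simp⟩
      simp at g1 g2 g3 f1 f2 f3
      have p := hx (k + 1)
      have q := hx' (k' + 1)
      simp only [add_assoc, Nat.reduceAdd] at p q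
      rw [← g1, ← g2, ← g3] at p
      rw [← f1, ← f2, ← f3] at q
      omega
  · rintro rfl
    refine ⟨h3.2.2, ?_⟩
    intro t ht
    simp at ht
    rcases ht with rfl | rfl | rfl
    · exact h3.2.2
    · exact h1.1
    · exact h2.1

theorem constr_c : Constructible X3 {([2] : List (Fin 3))} := by
  have h1 := mem3 0 1 2 (by decide) (by decide) (by decide)
  have h2 := mem3 1 0 2 (by decide) (by decide) (by decide)
  refine Or.inr ⟨{[], [0, 1], [1, 0]}, [], ?_, ⟨[0, 1], by simp, h1.2.1⟩, by simp, ?_⟩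
  · intro t ht
    simp at ht
    rcases ht with rfl | rfl | rfl
    · exact Or.inl rfl
    · exact Or.inr h1.2.1
    · exact Or.inr h2.2.1
  · rw [FLam_c]; simp

theorem psi1_iff (A : Set (List (Fin 3))) : psi1 A = true ↔ [2] ∈ A := by
  simp [psi1]

theorem constr_form {A : Set (List (Fin 3))} (h : Constructible X3 A) (h2 : [2] ∈ A) :
    ∃ Λ : Finset (List (Fin 3)), (∀ t ∈ Λ, t = [] ∨ t ∈ language X3) ∧
      (∃ t ∈ Λ, t ∈ language X3) ∧ [] ∈ Λ ∧ A = FLam X3 Λ := by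
  rcases h with rfl | ⟨Λ, u, hA, hB, hu, rfl⟩
  · exact absurd h2 (by simp)
  · obtain ⟨s, hs, hus⟩ := h2
    have hs0 : s ≠ [] := hs.1.1
    have : u = [] := by
      rcases u with _ | ⟨x, u⟩
      · rfl
      · simp at hus
        exact absurd hus.2.2 hs0
    subst this
    exact ⟨Λ, hA, hB, hu, by simp⟩

theorem constr_inter {A B : Set (List (Fin 3))} (hA : Constructible X3 A) (h2 : [2] ∈ A)
    (hB : Constructible X3 B) (h3 : [2] ∈ B) : Constructible X3 (A ∩ B) := by
  classical
  obtain ⟨Λ, a1, ⟨t, a2, a2'⟩, a3, rfl⟩ := constr_form hA h2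
  obtain ⟨M, b1, b2, b3, rfl⟩ := constr_form hB h3
  refine Or.inr ⟨Λ ∪ M, [], ?_, ⟨t, by simp [a2], a2'⟩, by simp [a3], ?_⟩
  · intro t ht
    rcases Finset.mem_union.1 ht with h | h
    · exact a1 t h
    · exact b1 t h
  · ext s
    simp only [FLam, Set.mem_inter_iff, Set.mem_setOf_eq, Finset.mem_union, List.nil_append,
      Set.image_id']
    constructor
    · rintro ⟨⟨h, h'⟩, -, h''⟩
      exact ⟨h, fun t ht => ht.elim (h' t) (h'' t)⟩
    · rintro ⟨h, h'⟩
      exact ⟨⟨h, fun t ht => h' t (Or.inl ht)⟩, h, fun t ht => h' t (Or.inr ht)⟩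

theorem infPrefixes_infinite (ω : ℕ → Fin 3) : (infPrefixes ω).Infinite := by
  refine Set.infinite_of_injective_forall_mem
    (f := fun n : ℕ => List.ofFn (fun i : Fin (n + 1) => ω i)) ?_ ?_
  · intro m n h
    have := congrArg List.length h
    simpa using this
  · intro n
    refine ⟨by simp, ?_⟩
    intro i
    rw [List.get_eq_getElem, List.getElem_ofFn]

/-- **Proposition.** In the subshift `X3`, the map `ψ₁` is an ultra-character on `E(X)`
which is not essentially tight; consequently `ψ₁ ≠ φ_ω` for every `ω ∈ X` (they differ on
some constructible set). -/
theorem stmt_15 :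
    IsUltraChar X3 psi1 ∧
    ¬ IsEssTightChar X3 psi1 ∧
    ∀ ω ∈ X3, ∃ A : Set (List (Fin 3)), Constructible X3 A ∧
      ¬ (psi1 A = true ↔ (infPrefixes ω \ A).Finite) := by
  refine ⟨⟨⟨?_, ?_, ?_⟩, ⟨?_, ?_, ?_⟩, ?_⟩, ?_, ?_⟩
  · simp [psi1]
  · intro A B _ _
    rw [Bool.eq_iff_iff, Bool.and_eq_true, psi1_iff, psi1_iff, psi1_iff]
    rfl
  · exact ⟨_, constr_c, (psi1_iff _).2 rfl⟩
  · rintro A ⟨hA, h⟩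
    refine ⟨hA, ?_⟩
    rintro rfl
    exact absurd ((psi1_iff _).1 h) (by simp)
  · rintro A ⟨hA, h⟩ B ⟨hB, h'⟩
    rw [psi1_iff] at h h'
    exact ⟨constr_inter hA h hB h', (psi1_iff _).2 ⟨h, h'⟩⟩
  · rintro A ⟨hA, h⟩ B hB hAB
    rw [psi1_iff] at h
    exact ⟨hB, (psi1_iff _).2 (hAB h)⟩
  · intro ξ' hξ hsub
    refine Set.Subset.antisymm ?_ hsub
    intro B hB
    refine ⟨(hξ.1 B hB).1, (psi1_iff _).2 ?_⟩
    have hc : {[2]} ∈ ξ' := hsub ⟨constr_c, (psi1_iff _).2 rfl⟩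
    obtain ⟨s, hs, hs'⟩ := Set.nonempty_iff_ne_empty.2 (hξ.1 _ (hξ.2.1 B hB _ hc)).2
    rw [Set.mem_singleton_iff] at hs'
    exact hs' ▸ hs
  · intro h
    have := (h {[2]} 0 (fun i => ∅) constr_c (fun i => i.elim0) (by simp)).1 ((psi1_iff _).2 rfl)
    obtain ⟨i, -⟩ := this
    exact i.elim0
  · intro ω _
    refine ⟨{[2]}, constr_c, ?_⟩
    intro h
    exact (infPrefixes_infinite ω).diff (Set.finite_singleton _) (h.1 ((psi1_iff _).2 rfl))
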